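/- Let M₆ be the Turing machine with states {A,B,C,D,E,F,H} and symbols {0,1} whose transition table is: δ(A,0)=(1,R,B), δ(A,1)=(0,R,F); δ(B,0)=(0,L,B), δ(B,1)=(1,L,C); δ(C,0)=(1,L,D), δ(C,1)=(0,R,C); δ(D,0)=(1,L,E), δ(D,1)=(1,R,H); δ(E,0)=(1,L,F), δ(E,1)=(0,L,D); δ(F,0)=(1,R,A), δ(F,1)=(0,L,E). For n, p ≥ 0 let C(n,p) = ^ω0 (F0) (10)^n w(p) 0^ω, where w(p) is the little-endian binary digit string of p (i.e., the reverse of the usual binary writing of p; w(0) is the empty word); note C(k, 4m+1) = C(k+1, m). Then: (a) ^ω0 (A0) 0^ω ⊢(6) C(0,15); and for all k, m ≥ 0: (b) C(k, 4m+3) ⊢(4k+6) C(k+2, m); (c) C(2k, 4m) ⊢(30k²+20k+15) C(5k+2, 2m+1); (d) C(2k+1, 4m) ⊢(30k²+40k+25) C(5k+2, 32m+20); (e) C(k, 8m+2) ⊢(8k+20) C(k+3, 2m+1); (f) C(2k, 16m+6) ⊢(30k²+40k+23) C(5k+2, 32m+20); (g) C(2k+1, 16m+6) ⊢(30k²+80k+63)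 C(5k+7, 2m+1); (h) C(k, 32m+14) ⊢(4k+18) C(k+3, 2m+1); (i) C(2k, 128m+94) ⊢(30k²+40k+39) C(5k+2, 256m+84); (j) C(2k+1, 128m+94) ⊢(30k²+80k+79) C(5k+9, m); (k) C(k, 256m+190) ⊢(4k+34) C(k+5, m); (l) C(k, 512m+30) ⊢(2k+43) ^ω0 (10)^k 1 (H0) (10)^2 (01)^2 w(m) 0^ω. -/

import Mathlib

open Turing

inductive TSt where | A | B | C | D | E | F | H
deriving DecidableEq

inductive Gam where | s0 | s1
deriving DecidableEq

instance : Inhabited Gam := ⟨Gam.s0⟩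

abbrev Cfg := TSt × Tape Gam

/-- The transition table of the machine (values from the halting state `H` are never used). -/
def delta : TSt → Gam → Gam × Dir × TSt
  | .A, .s0 => (.s1, Dir.right, .B)
  | .A, .s1 => (.s0, Dir.right, .F)
  | .B, .s0 => (.s0, Dir.left, .B)
  | .B, .s1 => (.s1, Dir.left, .C)
  | .C, .s0 => (.s1, Dir.left, .D)
  | .C, .s1 => (.s0, Dir.right, .C)
  | .D, .s0 => (.s1, Dir.left, .E)
  | .D, .s1 => (.s1, Dir.right, .H)
  | .E, .s0 => (.s1, Dir.left, .F)
  | .E, .s1 => (.s0, Dir.left, .D)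
  | .F, .s0 => (.s1, Dir.right, .A)
  | .F, .s1 => (.s0, Dir.left, .E)
  | .H, a => (a, Dir.right, .H)

/-- One computation step; `none` if the current state is the halting state `H`. -/
def step (c : Cfg) : Option Cfg :=
  if c.1 = TSt.H then none
  else
    let t := delta c.1 c.2.head
    some (t.2.2, (c.2.write t.1).move t.2.1)

/-- `reaches t c₁ c₂` : iterating `step` exactly `t` times starting from `c₁` yields `c₂`. -/
def reaches (t : ℕ) (c₁ c₂ : Cfg) : Prop :=
  (fun c => Option.bind c step)^[t] (some c₁) = some c₂

/-- The configuration `^ω0 x (q a) y 0^ω` : state `q`, head reading `a`, the word `x`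
written immediately to the left of the head (in order), `y` immediately to the right,
blank elsewhere. -/
def mkCfg (x : List Gam) (q : TSt) (a : Gam) (y : List Gam) : Cfg :=
  (q, ⟨a, ListBlank.mk x.reverse, ListBlank.mk y⟩)

/-- The little-endian binary digit string of `p`, as a word over the tape alphabet. -/
def w (p : ℕ) : List Gam :=
  (Nat.digits 2 p).map (fun d => if d = 1 then Gam.s1 else Gam.s0)

/-- `C(n,p) = ^ω0 (F0) (10)^n w(p) 0^ω`. -/
def Cfg6 (n p : ℕ) : Cfg :=
  mkCfg [] .F .s0 ((List.replicate n [Gam.s1, .s0]).flatten ++ w p)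

namespace TuringSix

open Gam

/-- Two runs of the machine can be concatenated; the total time is given up to equality. -/
theorem reaches_trans {s t u : ℕ} {a b c : Cfg} (h₁ : reaches s a b) (h₂ : reaches t b c)
    (hu : u = s + t) : reaches u a c := by
  subst hu
  unfold reaches at *
  rw [add_comm, Function.iterate_add_apply, h₁, h₂]

/-- The configuration in state `q` with `l` to the left of the head (nearest cell first) and `r`
starting at the head. -/
def conf (q : TSt) (l r : List Gam) : Cfg :=
  (q, ⟨(ListBlank.mk r).head, ListBlank.mk l, (ListBlank.mk r).tail⟩)

theorem reaches_right {q q' : TSt} {a b : Gam} {t : ℕ} {l r : List Gam} {c : Cfg}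
    (hd : delta q a = (b, Dir.right, q')) (hq : q ≠ .H) (h : reaches t (conf q' (b :: l) r) c) :
    reaches (t + 1) (conf q l (a :: r)) c := by
  refine reaches_trans (s := 1) ?_ h (Nat.add_comm t 1)
  simp [reaches, step, conf, hd, hq, Tape.write, Tape.move, ← ListBlank.cons_mk]

theorem reaches_left {q q' : TSt} {a b d : Gam} {t : ℕ} {l r : List Gam} {c : Cfg}
    (hd : delta q a = (b, Dir.left, q')) (hq : q ≠ .H)
    (h : reaches t (conf q' l (d :: b :: r)) c) :
    reaches (t + 1) (conf q (d :: l) (a :: r)) c := by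
  refine reaches_trans (s := 1) ?_ h (Nat.add_comm t 1)
  simp [reaches, step, conf, hd, hq, Tape.write, Tape.move, ← ListBlank.cons_mk]

theorem reaches_left_nil {q q' : TSt} {a b : Gam} {t : ℕ} {r : List Gam} {c : Cfg}
    (hd : delta q a = (b, Dir.left, q')) (hq : q ≠ .H)
    (h : reaches t (conf q' [] (s0 :: b :: r)) c) :
    reaches (t + 1) (conf q [] (a :: r)) c := by
  refine reaches_trans (s := 1) ?_ h (Nat.add_comm t 1)
  simp [reaches, step, conf, hd, hq, Tape.write, Tape.move, ← ListBlank.cons_mk]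
  rfl

/-- `rep10 n r` is the word `(10)^n r`. -/
def rep10 : ℕ → List Gam → List Gam
  | 0, r => r
  | n + 1, r => s1 :: s0 :: rep10 n r

/-- `rep01 n r` is the word `(01)^n r`. -/
def rep01 : ℕ → List Gam → List Gam
  | 0, r => r
  | n + 1, r => s0 :: s1 :: rep01 n r

theorem rep10_shift (n : ℕ) (r : List Gam) : rep10 n (s1 :: s0 :: r) = rep10 (n + 1) r := by
  induction n with
  | zero => rfl
  | succ n ih => rw [rep10, ih]; rfl

theorem rep01_cons (n : ℕ) (r : List Gam) : rep01 n (s0 :: r) = s0 :: rep10 n r := by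
  induction n with
  | zero => rfl
  | succ n ih => rw [rep01, ih]; rfl

theorem rep10_cons (n : ℕ) (r : List Gam) : rep10 n (s1 :: r) = s1 :: rep01 n r := by
  induction n with
  | zero => rfl
  | succ n ih => rw [rep10, ih]; rfl

theorem rep10_rep10 (m n : ℕ) (r : List Gam) : rep10 m (rep10 n r) = rep10 (m + n) r := by
  induction m with
  | zero => rw [Nat.zero_add]; rfl
  | succ m ih => rw [rep10, ih, Nat.succ_add]; rfl

theorem rep01_rep01 (m n : ℕ) (r : List Gam) : rep01 m (rep01 n r) = rep01 (m + n) r := by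
  induction m with
  | zero => rw [Nat.zero_add]; rfl
  | succ m ih => rw [rep01, ih, Nat.succ_add]; rfl

theorem rep10_eq_flatten (n : ℕ) (r : List Gam) :
    rep10 n r = (List.replicate n [s1, s0]).flatten ++ r := by
  induction n with
  | zero => rfl
  | succ n ih => simp [rep10, ih, List.replicate_succ]

theorem flatten_reverse (n : ℕ) :
    ((List.replicate n [s1, s0]).flatten ++ [s1]).reverse = rep10 n [s1] := by
  induction n with
  | zero => rfl
  | succ n ih =>
    rw [List.replicate_succ, List.flatten_cons, List.append_assoc, List.reverse_append, ih,
      ← rep10_shift]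
    clear ih
    induction n with
    | zero => rfl
    | succ n ih => simpa [rep10] using ih

/-- The configuration `^ω0 (F0) (10)^n r 0^ω`. -/
def start (n : ℕ) (r : List Gam) : Cfg := conf .F [] (s0 :: rep10 n r)

theorem start_rep10 (m n : ℕ) (r : List Gam) : start m (rep10 n r) = start (m + n) r := by
  rw [start, rep10_rep10, start]

theorem mk_rep10_congr {r r' : List Gam} (h : ListBlank.mk r = ListBlank.mk r') (n : ℕ) :
    ListBlank.mk (rep10 n r) = ListBlank.mk (rep10 n r') := by
  induction n with
  | zero => exact h
  | succ n ih => simp only [rep10, ← ListBlank.cons_mk, ih]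

/-- The number whose little-endian binary digits are `b` followed by those of `m`. -/
def prependDigits (b : List Gam) (m : ℕ) : ℕ :=
  b.foldr (fun a p => 2 * p + if a = s1 then 1 else 0) m

theorem mk_w_two_mul (m : ℕ) : ListBlank.mk (w (2 * m)) = ListBlank.mk (s0 :: w m) := by
  rcases Nat.eq_zero_or_pos m with rfl | hm
  · exact (Quotient.sound' (Or.inl ⟨1, by simp [w]; rfl⟩))
  · simp [w, Nat.digits_def' one_lt_two (show 0 < 2 * m by omega)]

theorem w_two_mul_add_one (m : ℕ) : w (2 * m + 1) = s1 :: w m := by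
  simp [w, show (2 * m + 1) / 2 = m by omega, Nat.add_mod]

theorem mk_w_prependDigits (b : List Gam) (m : ℕ) :
    ListBlank.mk (w (prependDigits b m)) = ListBlank.mk (b ++ w m) := by
  induction b with
  | nil => rfl
  | cons a b ih =>
    rw [List.cons_append, ← ListBlank.cons_mk, ← ih, ListBlank.cons_mk]
    cases a
    · exact mk_w_two_mul _
    · exact congrArg _ (w_two_mul_add_one _)

theorem cfg6_eq_start (b : List Gam) (n m p : ℕ) (hp : p = prependDigits b m) :
    Cfg6 n p = start n (b ++ w m) := by
  subst hp
  rw [Cfg6, ← rep10_eq_flatten, start, mkCfg, conf, ← ListBlank.cons_mk, ListBlank.head_cons,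
    ListBlank.tail_cons, mk_rep10_congr (mk_w_prependDigits b m) n]
  rfl

/-! ### Sweeps over periodic words -/

theorem sweep_right (n : ℕ) (l r : List Gam) :
    reaches (2 * n) (conf .A l (rep10 n r)) (conf .A (rep10 n l) r) := by
  induction n generalizing l with
  | zero => rfl
  | succ n ih =>
    have h : reaches 2 (conf .A l (rep10 (n + 1) r)) (conf .A (s1 :: s0 :: l) (rep10 n r)) := rfl
    rw [← rep10_shift n l]
    exact reaches_trans h (ih _) (by ring)

theorem sweep_left_F (n : ℕ) (l r : List Gam) :
    reaches (2 * n) (conf .F (rep01 n l) (s1 :: r)) (conf .F l (s1 :: rep10 n r)) := by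
  induction n generalizing r with
  | zero => rfl
  | succ n ih =>
    have h : reaches 2 (conf .F (rep01 (n + 1) l) (s1 :: r))
        (conf .F (rep01 n l) (s1 :: s1 :: s0 :: r)) := rfl
    rw [← rep10_shift n r]
    exact reaches_trans h (ih _) (by ring)

theorem sweep_left_E (n : ℕ) (l r : List Gam) :
    reaches (2 * n) (conf .E (rep01 n l) (s1 :: r)) (conf .E l (s1 :: rep10 n r)) := by
  induction n generalizing r with
  | zero => rfl
  | succ n ih =>
    have h : reaches 2 (conf .E (rep01 (n + 1) l) (s1 :: r))
        (conf .E (rep01 n l) (s1 :: s1 :: s0 :: r)) := rfl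
    rw [← rep10_shift n r]
    exact reaches_trans h (ih _) (by ring)

theorem start_sweep (n : ℕ) (r : List Gam) :
    reaches (2 * n + 1) (start n r) (conf .A (rep10 n [s1]) r) := by
  have h : reaches 1 (start n r) (conf .A [s1] (rep10 n r)) := rfl
  exact reaches_trans h (sweep_right n _ _) (by ring)

/-! ### Runs between start configurations -/

/-- A run on the right part of the tape that turns around in state `F` leads back to a start
configuration. -/
theorem start_of_turn_F {t u : ℕ} (n : ℕ) {r r' : List Gam}
    (h : ∀ l, reaches t (conf .A (s1 :: l) r) (conf .F l (s1 :: r'))) (hu : u = 4 * n + t + 3) :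
    reaches u (start n r) (start (n + 1) r') := by
  have h' : reaches 2 (conf .F [] (s1 :: rep10 n r')) (start (n + 1) r') := rfl
  have hs := start_sweep n r
  rw [rep10_cons] at hs
  exact reaches_trans (reaches_trans (reaches_trans hs (h _) rfl) (sweep_left_F n _ _) rfl) h'
    (by omega)

theorem start_one_one (n : ℕ) (r : List Gam) :
    reaches (4 * n + 6) (start n (s1 :: s1 :: r)) (start (n + 2) r) :=
  (start_of_turn_F (t := 3) (r := s1 :: s1 :: r) (r' := s1 :: s0 :: r) n (fun _ => rfl) rfl).trans
    (congrArg some (start_rep10 (n + 1) 1 r))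

theorem start_zero_one_zero (n : ℕ) (r : List Gam) :
    reaches (8 * n + 20) (start n (s0 :: s1 :: s0 :: r)) (start (n + 3) (s1 :: r)) :=
  reaches_trans
    (start_of_turn_F (t := 7) (r' := s1 :: s1 :: s1 :: r) n (fun _ => rfl) rfl)
    (start_one_one (n + 1) _) (by ring)

theorem start_rep01 (j n : ℕ) (r : List Gam) :
    reaches (12 * n * j + 30 * j ^ 2 + 8 * j) (start n (rep01 (2 * j) r))
      (start (n + 5 * j) r) := by
  induction j generalizing n with
  | zero => rfl
  | succ j ih =>
    have h := reaches_trans (start_zero_one_zero n (s1 :: rep01 (2 * j) r))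
      (start_one_one (n + 3) _) rfl
    rw [show n + 5 * (j + 1) = n + 5 + 5 * j by ring]
    exact reaches_trans h (ih (n + 5)) (by ring)

theorem start_rep01_odd (j n : ℕ) (r : List Gam) :
    reaches (12 * n * j + 30 * j ^ 2 + 48 * j + 8 * n + 20) (start n (rep01 (2 * j + 1) (s0 :: r)))
      (start (n + 5 * j + 3) (s1 :: r)) := by
  rw [← rep01_rep01]
  exact reaches_trans (start_rep01 j n _) (start_zero_one_zero _ r) (by ring)

theorem turn_E_left_end (n : ℕ) (r : List Gam) :
    reaches (2 * n + 9) (conf .E (rep01 n []) (s1 :: s0 :: r))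
      (start 2 (rep01 n (s0 :: s0 :: r))) := by
  have h : reaches 3 (conf .E [] (s1 :: rep10 n (s0 :: r)))
    (start 0 (s1 :: s1 :: s0 :: rep10 n (s0 :: r))) := rfl
  rw [rep01_cons]
  exact reaches_trans (reaches_trans (sweep_left_E n _ _) h rfl) (start_one_one 0 _) (by ring)

/-- A run on the right part of the tape that turns around in state `E`, one cell to the left of
its starting cell. -/
theorem start_of_turn_E {t u : ℕ} (n : ℕ) {r r' : List Gam}
    (h : ∀ l, reaches t (conf .A (s1 :: s0 :: l) r) (conf .E (s0 :: l) (s1 :: s0 :: r')))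
    (hu : u = 4 * n + t + 14) :
    reaches u (start (n + 1) r) (start 2 (rep01 (n + 1) (s0 :: s0 :: r'))) := by
  have hl : s0 :: rep10 n [s1] = rep01 (n + 1) [] := by rw [rep10_cons]; rfl
  have hr : reaches t (conf .A (rep10 (n + 1) [s1]) r)
      (conf .E (rep01 (n + 1) []) (s1 :: s0 :: r')) := by
    rw [← hl]
    exact h _
  have hs := reaches_trans (start_sweep (n + 1) r) hr rfl
  exact reaches_trans hs (turn_E_left_end (n + 1) r') (by omega)

theorem start_zero_zero (n : ℕ) (r : List Gam) :
    reaches (4 * n + 25) (start (n + 1) (s0 :: s0 :: r))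
      (start 2 (rep01 n (s0 :: s0 :: s1 :: s0 :: s1 :: r))) := by
  have h (l : List Gam) : reaches 13 (conf .A (s1 :: s0 :: s1 :: l) (s0 :: s0 :: r))
    (conf .E l (s1 :: s0 :: s1 :: s0 :: s1 :: r)) := by
    repeat first
      | refine reaches_right rfl nofun ?_
      | refine reaches_left rfl nofun ?_
      | refine reaches_left_nil rfl nofun ?_
    rfl
  have hs := start_sweep (n + 1) (s0 :: s0 :: r)
  rw [rep10, rep10_cons] at hs
  exact reaches_trans (reaches_trans hs (h _) rfl) (turn_E_left_end n _) (by ring)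

theorem start_six (n : ℕ) (r : List Gam) :
    reaches (4 * n + 27) (start (n + 1) (s0 :: s1 :: s1 :: s0 :: r))
      (start 2 (rep01 (n + 1) (s0 :: s0 :: s1 :: s0 :: s1 :: r))) := by
  refine start_of_turn_E (t := 13) (r' := s1 :: s0 :: s1 :: r) n
    (fun l => ?_) rfl
  repeat first
    | refine reaches_right rfl nofun ?_
    | refine reaches_left rfl nofun ?_
    | refine reaches_left_nil rfl nofun ?_
  rfl

theorem start_ninety_four (n : ℕ) (r : List Gam) :
    reaches (4 * n + 43) (start (n + 1) (s0 :: s1 :: s1 :: s1 :: s1 :: s0 :: s1 :: r))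
      (start 2 (rep01 (n + 1) (s0 :: s0 :: s1 :: s0 :: s1 :: s0 :: s1 :: s0 :: r))) := by
  refine start_of_turn_E (t := 29) (r' := s1 :: s0 :: s1 :: s0 :: s1 :: s0 :: r) n
    (fun l => ?_) rfl
  repeat first
    | refine reaches_right rfl nofun ?_
    | refine reaches_left rfl nofun ?_
    | refine reaches_left_nil rfl nofun ?_
  rfl

theorem start_fourteen (n : ℕ) (r : List Gam) :
    reaches (4 * n + 18) (start n (s0 :: s1 :: s1 :: s1 :: s0 :: r)) (start (n + 3) (s1 :: r)) := by
  refine (start_of_turn_F (t := 15) (r' := s1 :: s0 :: s1 :: s0 :: s1 :: r) n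
    (fun l => ?_) rfl).trans
    (congrArg some (start_rep10 (n + 1) 2 _))
  repeat first
    | refine reaches_right rfl nofun ?_
    | refine reaches_left rfl nofun ?_
    | refine reaches_left_nil rfl nofun ?_
  rfl

theorem start_one_hundred_ninety (n : ℕ) (r : List Gam) :
    reaches (4 * n + 34) (start n (s0 :: s1 :: s1 :: s1 :: s1 :: s1 :: s0 :: s1 :: r))
      (start (n + 5) r) := by
  refine (start_of_turn_F (t := 31) (r' := s1 :: s0 :: s1 :: s0 :: s1 :: s0 :: s1 :: s0 :: r) n
    (fun l => ?_) rfl).trans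
    (congrArg some (start_rep10 (n + 1) 4 _))
  repeat first
    | refine reaches_right rfl nofun ?_
    | refine reaches_left rfl nofun ?_
    | refine reaches_left_nil rfl nofun ?_
  rfl

theorem start_thirty (n : ℕ) (r : List Gam) :
    reaches (2 * n + 43) (start n (s0 :: s1 :: s1 :: s1 :: s1 :: s0 :: s0 :: s0 :: s0 :: r))
      (conf .H (rep10 n [s1]) (s0 :: s1 :: s0 :: s1 :: s0 :: s0 :: s1 :: s0 :: s1 :: r)) := by
  have h (l : List Gam) : reaches 42
      (conf .A (s1 :: l) (s0 :: s1 :: s1 :: s1 :: s1 :: s0 :: s0 :: s0 :: s0 :: r))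
      (conf .H (s1 :: l) (s0 :: s1 :: s0 :: s1 :: s0 :: s0 :: s1 :: s0 :: s1 :: r)) := by
    repeat first
      | refine reaches_right rfl nofun ?_
      | refine reaches_left rfl nofun ?_
      | refine reaches_left_nil rfl nofun ?_
    rfl
  have hs := start_sweep n (s0 :: s1 :: s1 :: s1 :: s1 :: s0 :: s0 :: s0 :: s0 :: r)
  rw [rep10_cons] at hs ⊢
  exact reaches_trans hs (h _) rfl

theorem start_even_zero (k : ℕ) (r : List Gam) :
    reaches (30 * k ^ 2 + 20 * k + 15) (start (2 * k) (s0 :: s0 :: r))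
      (start (5 * k + 2) (s1 :: r)) := by
  rcases k with _ | k
  · show reaches 15 (conf .F [] (s0 :: s0 :: s0 :: r)) (start 2 (s1 :: r))
    repeat first
      | refine reaches_right rfl nofun ?_
      | refine reaches_left rfl nofun ?_
      | refine reaches_left_nil rfl nofun ?_
    rfl
  · rw [show 5 * (k + 1) + 2 = 2 + 5 * k + 3 + 2 by ring, ← start_rep10 (2 + 5 * k + 3)]
    exact reaches_trans (start_zero_zero (2 * k + 1) r)
      (start_rep01_odd k 2 (s0 :: s1 :: s0 :: s1 :: r)) (by ring)

theorem start_odd_zero (k : ℕ) (r : List Gam) :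
    reaches (30 * k ^ 2 + 40 * k + 25) (start (2 * k + 1) (s0 :: s0 :: r))
      (start (5 * k + 2) (s0 :: s0 :: s1 :: s0 :: s1 :: r)) := by
  rw [add_comm (5 * k)]
  exact reaches_trans (start_zero_zero (2 * k) r) (start_rep01 k 2 _) (by ring)

theorem start_even_six (k : ℕ) (r : List Gam) :
    reaches (30 * k ^ 2 + 40 * k + 23) (start (2 * k) (s0 :: s1 :: s1 :: s0 :: r))
      (start (5 * k + 2) (s0 :: s0 :: s1 :: s0 :: s1 :: r)) := by
  rcases k with _ | k
  · show reaches 23 (conf .F [] (s0 :: s0 :: s1 :: s1 :: s0 :: r))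
      (start 2 (s0 :: s0 :: s1 :: s0 :: s1 :: r))
    repeat first
      | refine reaches_right rfl nofun ?_
      | refine reaches_left rfl nofun ?_
      | refine reaches_left_nil rfl nofun ?_
    rfl
  · rw [add_comm (5 * (k + 1))]
    exact reaches_trans (start_six (2 * k + 1) r) (start_rep01 (k + 1) 2 _) (by ring)

theorem start_odd_six (k : ℕ) (r : List Gam) :
    reaches (30 * k ^ 2 + 80 * k + 63) (start (2 * k + 1) (s0 :: s1 :: s1 :: s0 :: r))
      (start (5 * k + 7) (s1 :: r)) := by
  rw [show 5 * k + 7 = 2 + 5 * k + 3 + 2 by ring, ← start_rep10 (2 + 5 * k + 3)]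
  exact reaches_trans (start_six (2 * k) r)
    (start_rep01_odd k 2 (s0 :: s1 :: s0 :: s1 :: r)) (by ring)

theorem start_even_ninety_four (k : ℕ) (r : List Gam) :
    reaches (30 * k ^ 2 + 40 * k + 39) (start (2 * k) (s0 :: s1 :: s1 :: s1 :: s1 :: s0 :: s1 :: r))
      (start (5 * k + 2) (s0 :: s0 :: s1 :: s0 :: s1 :: s0 :: s1 :: s0 :: r)) := by
  rcases k with _ | k
  · show reaches 39 (conf .F [] (s0 :: s0 :: s1 :: s1 :: s1 :: s1 :: s0 :: s1 :: r))
      (start 2 (s0 :: s0 :: s1 :: s0 :: s1 :: s0 :: s1 :: s0 :: r))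
    repeat first
      | refine reaches_right rfl nofun ?_
      | refine reaches_left rfl nofun ?_
      | refine reaches_left_nil rfl nofun ?_
    rfl
  · rw [add_comm (5 * (k + 1))]
    exact reaches_trans (start_ninety_four (2 * k + 1) r) (start_rep01 (k + 1) 2 _) (by ring)

theorem start_odd_ninety_four (k : ℕ) (r : List Gam) :
    reaches (30 * k ^ 2 + 80 * k + 79)
      (start (2 * k + 1) (s0 :: s1 :: s1 :: s1 :: s1 :: s0 :: s1 :: r))
      (start (5 * k + 9) r) := by
  rw [show 5 * k + 9 = 2 + 5 * k + 3 + 4 by ring, ← start_rep10 (2 + 5 * k + 3)]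
  exact reaches_trans (start_ninety_four (2 * k) r)
    (start_rep01_odd k 2 (s0 :: s1 :: s0 :: s1 :: s0 :: s1 :: s0 :: r)) (by ring)

end TuringSix

theorem stmt17 :
    reaches 6 (mkCfg [] .A .s0 []) (Cfg6 0 15) ∧
    ∀ k m : ℕ,
      reaches (4*k + 6) (Cfg6 k (4*m+3)) (Cfg6 (k+2) m) ∧
      reaches (30*k^2 + 20*k + 15) (Cfg6 (2*k) (4*m)) (Cfg6 (5*k+2) (2*m+1)) ∧
      reaches (30*k^2 + 40*k + 25) (Cfg6 (2*k+1) (4*m)) (Cfg6 (5*k+2) (32*m+20)) ∧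
      reaches (8*k + 20) (Cfg6 k (8*m+2)) (Cfg6 (k+3) (2*m+1)) ∧
      reaches (30*k^2 + 40*k + 23) (Cfg6 (2*k) (16*m+6)) (Cfg6 (5*k+2) (32*m+20)) ∧
      reaches (30*k^2 + 80*k + 63) (Cfg6 (2*k+1) (16*m+6)) (Cfg6 (5*k+7) (2*m+1)) ∧
      reaches (4*k + 18) (Cfg6 k (32*m+14)) (Cfg6 (k+3) (2*m+1)) ∧
      reaches (30*k^2 + 40*k + 39) (Cfg6 (2*k) (128*m+94)) (Cfg6 (5*k+2) (256*m+84)) ∧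
      reaches (30*k^2 + 80*k + 79) (Cfg6 (2*k+1) (128*m+94)) (Cfg6 (5*k+9) m) ∧
      reaches (4*k + 34) (Cfg6 k (256*m+190)) (Cfg6 (k+5) m) ∧
      reaches (2*k + 43) (Cfg6 k (512*m+30))
        (mkCfg ((List.replicate k [Gam.s1, .s0]).flatten ++ [.s1]) .H .s0
          ([.s1, .s0, .s1, .s0] ++ [.s0, .s1, .s0, .s1] ++ w m)) := by
  open Gam TuringSix in
  refine ⟨?_, fun k m => ⟨?_, ?_, ?_, ?_, ?_, ?_, ?_, ?_, ?_, ?_, ?_⟩⟩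
  · rw [cfg6_eq_start [s1, s1, s1, s1, s0] 0 0 15 rfl]
    simp only [w, Nat.digits_zero, List.map_nil]
    rfl
  · rw [cfg6_eq_start [s1, s1] k m _ (by simp [prependDigits]; ring), cfg6_eq_start [] _ m m rfl]
    exact start_one_one k _
  · rw [cfg6_eq_start [s0, s0] _ m _ (by simp [prependDigits]; ring),
      cfg6_eq_start [s1] _ m _ (by simp [prependDigits])]
    exact start_even_zero k _
  · rw [cfg6_eq_start [s0, s0] _ m _ (by simp [prependDigits]; ring),
      cfg6_eq_start [s0, s0, s1, s0, s1] _ m _ (by simp [prependDigits]; ring)]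
    exact start_odd_zero k _
  · rw [cfg6_eq_start [s0, s1, s0] _ m _ (by simp [prependDigits]; ring),
      cfg6_eq_start [s1] _ m _ (by simp [prependDigits])]
    exact start_zero_one_zero k _
  · rw [cfg6_eq_start [s0, s1, s1, s0] _ m _ (by simp [prependDigits]; ring),
      cfg6_eq_start [s0, s0, s1, s0, s1] _ m _ (by simp [prependDigits]; ring)]
    exact start_even_six k _
  · rw [cfg6_eq_start [s0, s1, s1, s0] _ m _ (by simp [prependDigits]; ring),
      cfg6_eq_start [s1] _ m _ (by simp [prependDigits])]
    exact start_odd_six k _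
  · rw [cfg6_eq_start [s0, s1, s1, s1, s0] _ m _ (by simp [prependDigits]; ring),
      cfg6_eq_start [s1] _ m _ (by simp [prependDigits])]
    exact start_fourteen k _
  · rw [cfg6_eq_start [s0, s1, s1, s1, s1, s0, s1] _ m _ (by simp [prependDigits]; ring),
      cfg6_eq_start [s0, s0, s1, s0, s1, s0, s1, s0] _ m _ (by simp [prependDigits]; ring)]
    exact start_even_ninety_four k _
  · rw [cfg6_eq_start [s0, s1, s1, s1, s1, s0, s1] _ m _ (by simp [prependDigits]; ring),
      cfg6_eq_start [] _ m m rfl]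
    exact start_odd_ninety_four k _
  · rw [cfg6_eq_start [s0, s1, s1, s1, s1, s1, s0, s1] _ m _ (by simp [prependDigits]; ring),
      cfg6_eq_start [] _ m m rfl]
    exact start_one_hundred_ninety k _
  · rw [cfg6_eq_start [s0, s1, s1, s1, s1, s0, s0, s0, s0] _ m _ (by simp [prependDigits]; ring),
      mkCfg, flatten_reverse]
    exact start_thirty k _
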